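/- (Weissinger's fixed point theorem) Let Y be a Banach space, F ⊆ Y a nonempty closed subset, (α_k)_{k≥1} a sequence of nonnegative reals with ∑_{k≥1} α_k < ∞, and A : F → F a map such that for every k ≥ 1 and all φ, ψ ∈ F one has ‖A^k φ − A^k ψ‖ ≤ α_k·‖φ − ψ‖. Then A possesses a unique fixed point in F, and for every Φ ∈ F the sequence defined by ψ_0 = Φ, ψ_{k+1} = A ψ_k converges in Y to this fixed point. -/

import Mathlib

open Filter Topology

/-- Weissinger's fixed point theorem. -/
theorem stmt_15 {Y : Type*} [NormedAddCommGroup Y] [NormedSpace ℝ Y] [CompleteSpace Y]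
    (F : Set Y) (hne : F.Nonempty) (hcl : IsClosed F)
    (α : ℕ → ℝ) (hα : ∀ k, 1 ≤ k → 0 ≤ α k) (hsum : Summable α)
    (A : Y → Y) (hmaps : Set.MapsTo A F F)
    (hcontr : ∀ k, 1 ≤ k → ∀ φ ∈ F, ∀ ψ ∈ F, ‖A^[k] φ - A^[k] ψ‖ ≤ α k * ‖φ - ψ‖) :
    ∃ x, x ∈ F ∧ A x = x ∧ (∀ y ∈ F, A y = y → y = x) ∧
      ∀ Φ ∈ F, Tendsto (fun k => A^[k] Φ) atTop (𝓝 x) := by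
  have hiter : ∀ φ ∈ F, ∀ k, A^[k] φ ∈ F := fun φ hφ k => hmaps.iterate k hφ
  have hmerge : ∀ φ ∈ F, ∀ ψ ∈ F, Tendsto (fun k => A^[k] φ - A^[k] ψ) atTop (𝓝 0) := by
    intro φ hφ ψ hψ
    refine squeeze_zero_norm' (a := fun k => α k * ‖φ - ψ‖) ?_ ?_
    · filter_upwards [eventually_ge_atTop 1] with k hk using hcontr k hk φ hφ ψ hψ
    · simpa using hsum.tendsto_atTop_zero.mul_const ‖φ - ψ‖
  obtain ⟨Φ, hΦ⟩ := hne
  have hcauchy : CauchySeq (fun k => A^[k] Φ) := by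
    refine cauchySeq_of_summable_dist ((summable_nat_add_iff 1).1 ?_)
    refine Summable.of_nonneg_of_le (fun _ => dist_nonneg) (fun k => ?_)
      (((summable_nat_add_iff 1).2 hsum).mul_right ‖Φ - A Φ‖)
    simpa only [dist_eq_norm, Nat.succ_eq_add_one, Function.iterate_succ_apply] using
      hcontr (k + 1) (Nat.le_add_left 1 k) Φ hΦ (A Φ) (hmaps hΦ)
  obtain ⟨x, hx⟩ := cauchySeq_tendsto_of_complete hcauchy
  have hxF : x ∈ F := hcl.mem_of_tendsto hx (Eventually.of_forall (hiter Φ hΦ))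
  have hconv : ∀ Ψ ∈ F, Tendsto (fun k => A^[k] Ψ) atTop (𝓝 x) := by
    intro Ψ hΨ
    simpa using (hmerge Ψ hΨ Φ hΦ).add hx
  have hfix : A x = x := by
    have hAx : Tendsto (fun k => A^[k + 1] Φ) atTop (𝓝 (A x)) := by
      refine tendsto_iff_norm_sub_tendsto_zero.2 (squeeze_zero (fun _ => norm_nonneg _)
        (g := fun k => α 1 * ‖A^[k] Φ - x‖) (fun k => ?_) ?_)
      · simpa only [Function.iterate_succ_apply', Function.iterate_zero_apply] using
          hcontr 1 le_rfl _ (hiter Φ hΦ k) x hxF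
      · simpa using (tendsto_iff_norm_sub_tendsto_zero.1 hx).const_mul (α 1)
    exact tendsto_nhds_unique hAx ((tendsto_add_atTop_iff_nat 1).2 hx)
  refine ⟨x, hxF, hfix, fun y hy hAy => ?_, hconv⟩
  refine tendsto_nhds_unique ?_ (hconv y hy)
  simp only [Function.iterate_fixed hAy]
  exact tendsto_const_nhds
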